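/- arXiv:1408.3717 — 6 statements merged into one kernel-verified Lean document; each statement's English description precedes it below -/
import Mathlib

section
/- Let n₀ ∈ J^c. Then s(n₀) = (1/φ'(n₀)) · (1/N) · Σ_{p=0}^{N−1} (2πip/N) e^{2πipn₀/N} · ( Σ_{m∈J} s(m) φ(m) e^{−2πipm/N} ). (This is the paper's Theorem 1: the missing sample at n₀ equals the derivative of the zero-padded product signal s·φ at n₀, computed through its discrete Fourier transform, divided by φ'(n₀).) -/
open Finset

open Polynomial in
/-- Inversion of the discrete Fourier transform for polynomials of degree less than `N`. -/
theorem IsPrimitiveRoot.sum_eval_pow_mul_inv_pow {K : Type*} [Field K] {ζ : K} {N : ℕ}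
    (hζ : IsPrimitiveRoot ζ N) {Q : K[X]} (hQ : Q.natDegree < N) {p : ℕ} (hp : p < N) :
    ∑ m ∈ Finset.range N, Q.eval (ζ ^ m) * ((ζ ^ p) ^ m)⁻¹ = N * Q.coeff p := by
  have hN : N ≠ 0 := by omega
  have hζ0 : ζ ≠ 0 := hζ.ne_zero hN
  have geom : ∀ q ∈ Finset.range N, ∑ m ∈ Finset.range N, (ζ ^ q * (ζ ^ p)⁻¹) ^ m =
      if q = p then (N : K) else 0 := by
    intro q hq
    split_ifs with h
    · simp [h, hζ0]
    · have hx : ζ ^ q * (ζ ^ p)⁻¹ ≠ 1 := fun h1 ↦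
        h (hζ.pow_inj (Finset.mem_range.1 hq) hp
          ((mul_inv_eq_one₀ (pow_ne_zero _ hζ0)).1 h1))
      have hxN : (ζ ^ q * (ζ ^ p)⁻¹) ^ N = 1 := by
        rw [mul_pow, inv_pow, pow_right_comm, pow_right_comm ζ p, hζ.pow_eq_one]
        simp
      rw [geom_sum_eq hx, hxN, sub_self, zero_div]
  calc ∑ m ∈ Finset.range N, Q.eval (ζ ^ m) * ((ζ ^ p) ^ m)⁻¹
      = ∑ m ∈ Finset.range N, ∑ q ∈ Finset.range N,
          Q.coeff q * (ζ ^ q * (ζ ^ p)⁻¹) ^ m := by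
        refine Finset.sum_congr rfl fun m _ ↦ ?_
        rw [eval_eq_sum_range' hQ, Finset.sum_mul]
        refine Finset.sum_congr rfl fun q _ ↦ ?_
        rw [mul_pow, inv_pow, pow_right_comm ζ m q, mul_assoc]
    _ = ∑ q ∈ Finset.range N, Q.coeff q * if q = p then (N : K) else 0 := by
        rw [Finset.sum_comm]
        refine Finset.sum_congr rfl fun q hq ↦ ?_
        rw [← Finset.mul_sum, geom q hq]
    _ = N * Q.coeff p := by
        simp [hp, mul_comm]

open Polynomial in
/-- The operator `X * d/dX` multiplies the `p`-th coefficient by `p`. -/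
theorem Polynomial.mul_eval_derivative_eq_sum_range {R : Type*} [CommSemiring R] {Q : R[X]}
    {N : ℕ} (hQ : Q.natDegree < N) (x : R) :
    x * Q.derivative.eval x = ∑ p ∈ Finset.range N, p * x ^ p * Q.coeff p := by
  conv_lhs => rw [Q.as_sum_range' N hQ]
  rw [derivative_sum, eval_finsetSum, Finset.mul_sum]
  refine Finset.sum_congr rfl fun p _ ↦ ?_
  rw [derivative_monomial, eval_monomial]
  cases p with
  | zero => simp
  | succ p => rw [Nat.add_sub_cancel, pow_succ]; ring

/-- Theorem 1 of the paper: the missing sample at `n₀ ∈ Jᶜ` equals the derivative of the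
zero-padded product signal `s·φ` at `n₀`, computed through its DFT, divided by `φ'(n₀)`. -/
theorem missing_sample_formula
    (N P : ℕ) (hP : 0 < P) (hPN : P < N)
    (J : Finset ℕ) (hJsub : J ⊆ Finset.range N) (hJcard : J.card = P)
    (S : ℕ → ℂ)
    (s : ℝ → ℂ)
    (hs : ∀ t : ℝ, s t =
      ∑ p ∈ Finset.range P, S p * Complex.exp (2 * Real.pi * Complex.I * p * t / N))
    (φ : ℝ → ℂ)
    (hφ : ∀ t : ℝ, φ t =
      ∏ k ∈ Finset.range N \ J,
        (Complex.exp (2 * Real.pi * Complex.I * t / N) -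
          Complex.exp (2 * Real.pi * Complex.I * k / N)))
    (n₀ : ℕ) (hn₀ : n₀ ∈ Finset.range N \ J) :
    s n₀ = (1 / deriv φ n₀) * ((1 : ℂ) / N) *
      ∑ p ∈ Finset.range N,
        (2 * Real.pi * Complex.I * p / N) *
          Complex.exp (2 * Real.pi * Complex.I * p * n₀ / N) *
          (∑ m ∈ J, s m * φ m * Complex.exp (-(2 * Real.pi * Complex.I * p * m / N))) := by
  have hN : N ≠ 0 := by omega
  have hNC : (N : ℂ) ≠ 0 := Nat.cast_ne_zero.2 hN
  set ζ : ℂ := Complex.exp (2 * Real.pi * Complex.I / N) with hζdef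
  have hζ : IsPrimitiveRoot ζ N := Complex.isPrimitiveRoot_exp N hN
  have hexp (k : ℕ) : Complex.exp (2 * Real.pi * Complex.I * k / N) = ζ ^ k := by
    rw [hζdef, ← Complex.exp_nat_mul]; congr 1; ring
  have hexp_mul (p m : ℕ) :
      Complex.exp (2 * Real.pi * Complex.I * p * m / N) = (ζ ^ p) ^ m := by
    rw [← pow_mul, ← hexp]; push_cast; congr 1; ring
  set A : Polynomial ℂ := ∑ p ∈ Finset.range P, Polynomial.monomial p (S p) with hA
  set B : Polynomial ℂ :=
    ∏ k ∈ Finset.range N \ J, (Polynomial.X - Polynomial.C (ζ ^ k)) with hB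
  have hsA (t : ℝ) : s t = A.eval (Complex.exp (2 * Real.pi * Complex.I * t / N)) := by
    rw [hs, hA, Polynomial.eval_finsetSum]
    refine Finset.sum_congr rfl fun p _ ↦ ?_
    rw [Polynomial.eval_monomial, ← Complex.exp_nat_mul]
    congr 2; ring
  have hφB (t : ℝ) : φ t = B.eval (Complex.exp (2 * Real.pi * Complex.I * t / N)) := by
    simp [hφ, hB, Polynomial.eval_prod, hexp]
  have hsn (m : ℕ) : s m = A.eval (ζ ^ m) := by
    rw [hsA, Complex.ofReal_natCast, hexp]
  have hφn (m : ℕ) : φ m = B.eval (ζ ^ m) := by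
    rw [hφB, Complex.ofReal_natCast, hexp]
  have hB0 {m : ℕ} (hm : m ∈ Finset.range N \ J) : B.eval (ζ ^ m) = 0 := by
    rw [hB, Polynomial.eval_prod]
    exact Finset.prod_eq_zero hm (by simp)
  have hdeg : (A * B).natDegree < N := by
    have h1 : A.natDegree ≤ P - 1 := Polynomial.natDegree_sum_le_of_forall_le _ _ fun p hp ↦
      (Polynomial.natDegree_monomial_le _).trans (by have := Finset.mem_range.1 hp; omega)
    have h2 : B.natDegree = N - P := by
      rw [hB, Polynomial.natDegree_finsetProd_X_sub_C_eq_card,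
        Finset.card_sdiff_of_subset hJsub, hJcard, Finset.card_range]
    have := Polynomial.natDegree_mul_le (p := A) (q := B)
    omega
  have hB' : B.derivative.eval (ζ ^ n₀) ≠ 0 := by
    rw [hB, ← Finset.mul_prod_erase _ _ hn₀, Polynomial.derivative_mul]
    simp only [Polynomial.derivative_X_sub_C, one_mul, Polynomial.eval_add,
      Polynomial.eval_mul, Polynomial.eval_sub, Polynomial.eval_X, Polynomial.eval_C, sub_self,
      zero_mul, add_zero, Polynomial.eval_prod]
    refine Finset.prod_ne_zero_iff.2 fun k hk ↦ sub_ne_zero.2 fun h ↦ ?_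
    obtain ⟨hne, hk⟩ := Finset.mem_erase.1 hk
    exact hne (hζ.pow_inj (Finset.mem_range.1 (Finset.mem_sdiff.1 hn₀).1)
      (Finset.mem_range.1 (Finset.mem_sdiff.1 hk).1) h).symm
  have hderiv : deriv φ n₀ =
      2 * Real.pi * Complex.I / N * (ζ ^ n₀ * B.derivative.eval (ζ ^ n₀)) := by
    have h1 : HasDerivAt (fun t : ℝ ↦ 2 * Real.pi * Complex.I * (t : ℂ) / N)
        (2 * Real.pi * Complex.I / N) (n₀ : ℝ) := by
      simpa using ((Complex.ofRealCLM.hasDerivAt (x := (n₀ : ℝ))).const_mul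
        (2 * Real.pi * Complex.I)).div_const (N : ℂ)
    have h2 := (B.hasDerivAt _).comp (n₀ : ℝ) h1.cexp
    rw [show φ = _ from funext hφB]
    refine h2.deriv.trans ?_
    rw [Complex.ofReal_natCast, hexp]
    ring
  have hderiv0 : deriv φ n₀ ≠ 0 := by
    rw [hderiv]
    exact mul_ne_zero (div_ne_zero Complex.two_pi_I_ne_zero hNC)
      (mul_ne_zero (pow_ne_zero _ (hζ.ne_zero hN)) hB')
  have hinner : ∀ p ∈ Finset.range N,
      ∑ m ∈ J, s m * φ m * Complex.exp (-(2 * Real.pi * Complex.I * p * m / N)) =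
        N * (A * B).coeff p := by
    intro p hp
    rw [← hζ.sum_eval_pow_mul_inv_pow hdeg (Finset.mem_range.1 hp)]
    refine (Finset.sum_congr rfl fun m _ ↦ ?_).trans (Finset.sum_subset hJsub fun m hm hmJ ↦ ?_)
    · rw [Complex.exp_neg, hexp_mul, hsn, hφn, Polynomial.eval_mul]
    · rw [Polynomial.eval_mul, hB0 (Finset.mem_sdiff.2 ⟨hm, hmJ⟩), mul_zero, zero_mul]
  have hsum : ∑ p ∈ Finset.range N, (2 * Real.pi * Complex.I * p / N) *
      Complex.exp (2 * Real.pi * Complex.I * p * n₀ / N) *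
      (∑ m ∈ J, s m * φ m * Complex.exp (-(2 * Real.pi * Complex.I * p * m / N))) =
      N * (s n₀ * deriv φ n₀) := by
    have hprod : (A * B).derivative.eval (ζ ^ n₀) = s n₀ * B.derivative.eval (ζ ^ n₀) := by
      rw [Polynomial.derivative_mul, Polynomial.eval_add, Polynomial.eval_mul,
        Polynomial.eval_mul, hB0 hn₀, mul_zero, zero_add, hsn]
    calc _ = N * (2 * Real.pi * Complex.I / N) *
          ∑ p ∈ Finset.range N, p * (ζ ^ n₀) ^ p * (A * B).coeff p := by
          rw [Finset.mul_sum]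
          refine Finset.sum_congr rfl fun p hp ↦ ?_
          rw [hinner p hp, hexp_mul, pow_right_comm]
          ring
      _ = N * (s n₀ * deriv φ n₀) := by
          rw [← Polynomial.mul_eval_derivative_eq_sum_range hdeg, hprod, hderiv]
          ring
  rw [hsum]
  field_simp
end

section
/- For every n ∈ J^c, φ'(n)·φ₁(n) = 2πi, where φ' is the derivative of the function t ↦ φ(t) on ℝ. -/
open Finset

/-- The polynomial `X ^ N - 1` evaluated at `x` as a product over the `N`-th roots of unity. -/
lemma prod_range_sub_exp {N : ℕ} (hN : 0 < N) (x : ℂ) :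
    ∏ k ∈ Finset.range N, (x - Complex.exp (2 * Real.pi * Complex.I * k / N)) = x ^ N - 1 := by
  have h := congrArg (Polynomial.eval x)
    (X_pow_sub_C_eq_prod (Complex.isPrimitiveRoot_exp N hN.ne') hN (one_pow N))
  simp only [Polynomial.eval_sub, Polynomial.eval_pow, Polynomial.eval_X, Polynomial.eval_C,
    Polynomial.eval_prod, mul_one] at h
  rw [h]
  refine Finset.prod_congr rfl fun k _ => ?_
  rw [← Complex.exp_nat_mul]
  ring_nf

lemma differentiable_prod_exp_sub (N : ℕ) (s : Finset ℕ) :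
    Differentiable ℝ fun t : ℝ => ∏ k ∈ s,
      (Complex.exp (2 * Real.pi * Complex.I * t / N) -
        Complex.exp (2 * Real.pi * Complex.I * k / N)) := by
  have hid : Differentiable ℝ fun t : ℝ => (t : ℂ) := Complex.ofRealCLM.differentiable
  refine Differentiable.fun_finsetProd fun k _ => ?_
  exact (((hid.const_mul _).div_const _).cexp).sub_const _

/-- For every `n ∈ Jᶜ`, `φ'(n)·φ₁(n) = 2πi`. -/
theorem deriv_erasure_times_complement
    (N P : ℕ) (hP : 0 < P) (hPN : P < N)
    (J : Finset ℕ) (hJsub : J ⊆ Finset.range N) (hJcard : J.card = P)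
    (φ : ℝ → ℂ)
    (hφ : ∀ t : ℝ, φ t =
      ∏ k ∈ Finset.range N \ J,
        (Complex.exp (2 * Real.pi * Complex.I * t / N) -
          Complex.exp (2 * Real.pi * Complex.I * k / N)))
    (φ₁ : ℝ → ℂ)
    (hφ₁ : ∀ t : ℝ, φ₁ t =
      ∏ k ∈ J,
        (Complex.exp (2 * Real.pi * Complex.I * t / N) -
          Complex.exp (2 * Real.pi * Complex.I * k / N)))
    (n : ℕ) (hn : n ∈ Finset.range N \ J) :
    deriv φ n * φ₁ n = 2 * Real.pi * Complex.I := by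
  have hN : 0 < N := hP.trans hPN
  have hmul : (fun t : ℝ => φ t * φ₁ t) =
      fun t : ℝ => Complex.exp (2 * Real.pi * Complex.I * t) - 1 := by
    funext t
    rw [hφ, hφ₁, Finset.prod_sdiff hJsub, prod_range_sub_exp hN, ← Complex.exp_nat_mul,
      mul_div_cancel₀ _ (Nat.cast_ne_zero.mpr hN.ne')]
  have hdφ : DifferentiableAt ℝ φ n := by
    rw [funext hφ]
    exact differentiable_prod_exp_sub N _ _
  have hdφ₁ : DifferentiableAt ℝ φ₁ n := by
    rw [funext hφ₁]
    exact differentiable_prod_exp_sub N _ _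
  have hzero : φ n = 0 := by
    rw [hφ]
    exact Finset.prod_eq_zero hn (by simp)
  have hprod := hdφ.hasDerivAt.fun_mul hdφ₁.hasDerivAt
  have hexp : HasDerivAt (fun t : ℝ => Complex.exp (2 * Real.pi * Complex.I * t) - 1)
      (2 * Real.pi * Complex.I) (n : ℝ) := by
    have h := (((Complex.ofRealCLM.hasDerivAt (x := (n : ℝ))).const_mul
      (2 * Real.pi * Complex.I)).cexp).sub_const 1
    have hone : Complex.exp (2 * Real.pi * Complex.I * n) = 1 := by
      rw [mul_comm]
      exact Complex.exp_nat_mul_two_pi_mul_I n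
    simpa [hone] using h
  rw [hmul] at hprod
  simpa [hzero] using hprod.unique hexp
end

section
/- For every n ∈ J, φ(n) = exp( −2πinP/N + β(n) ), where β(n) = Σ_{k∈J^c} α(n−k). (This is the first formula of the paper's Theorem 2, giving the values of the erasure polynomial at the known sampling instants via a cyclic convolution of the indicator of J^c with the sequence α.) -/
open Finset

/-- If `N ∤ m` then `e^{-2πim/N} ≠ 1`. -/
theorem one_sub_exp_ne_zero_of_not_dvd {N : ℕ} (hN : N ≠ 0) {m : ℤ} (hm : ¬ (N : ℤ) ∣ m) :
    1 - Complex.exp (-(2 * Real.pi * Complex.I * m / N)) ≠ 0 := by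
  intro h
  obtain ⟨j, hj⟩ := Complex.exp_eq_one_iff.mp (sub_eq_zero.mp h).symm
  apply hm
  refine ⟨-j, ?_⟩
  have hN' : (N : ℂ) ≠ 0 := Nat.cast_ne_zero.mpr hN
  have hpi := Complex.two_pi_I_ne_zero
  have key : (m : ℂ) = N * -j := by
    apply mul_left_cancel₀ hpi
    field_simp at hj
    linear_combination -(2 * Real.pi * Complex.I) * hj
  exact_mod_cast key

/-- First formula of the paper's Theorem 2: for `n ∈ J`,
`φ(n) = exp(−2πinP/N + β(n))` where `β(n) = Σ_{k∈Jᶜ} α(n−k)`. -/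
theorem erasure_values_via_convolution
    (N P : ℕ) (hP : 0 < P) (hPN : P < N)
    (J : Finset ℕ) (hJsub : J ⊆ Finset.range N) (hJcard : J.card = P)
    (φ : ℝ → ℂ)
    (hφ : ∀ t : ℝ, φ t =
      ∏ k ∈ Finset.range N \ J,
        (Complex.exp (2 * Real.pi * Complex.I * t / N) -
          Complex.exp (2 * Real.pi * Complex.I * k / N)))
    (α : ℤ → ℂ)
    (hα : ∀ m : ℤ, α m =
      if (N : ℤ) ∣ m then 0
      else Complex.log (1 - Complex.exp (-(2 * Real.pi * Complex.I * m / N))))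
    (n : ℕ) (hn : n ∈ J) :
    φ n = Complex.exp (-(2 * Real.pi * Complex.I * n * P / N) +
      ∑ k ∈ Finset.range N \ J, α ((n : ℤ) - k)) := by
  have hN : N ≠ 0 := by omega
  have hN' : (N : ℂ) ≠ 0 := Nat.cast_ne_zero.mpr hN
  have hnN : n < N := Finset.mem_range.mp (hJsub hn)
  have hcard : (Finset.range N \ J).card = N - P := by
    rw [Finset.card_sdiff_of_subset hJsub, Finset.card_range, hJcard]
  have hfactor : ∀ k ∈ Finset.range N \ J,
      Complex.exp (2 * Real.pi * Complex.I * (n : ℝ) / N) -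
          Complex.exp (2 * Real.pi * Complex.I * k / N) =
        Complex.exp (2 * Real.pi * Complex.I * n / N) * Complex.exp (α ((n : ℤ) - k)) := by
    intro k hk
    obtain ⟨hkN, hkJ⟩ := Finset.mem_sdiff.mp hk
    rw [Finset.mem_range] at hkN
    have hne : n ≠ k := fun h => hkJ (h ▸ hn)
    have hdvd : ¬ (N : ℤ) ∣ (n : ℤ) - k := by
      intro h
      have := Int.eq_zero_of_abs_lt_dvd h (by rw [abs_lt]; omega)
      omega
    rw [hα, if_neg hdvd, Complex.exp_log (one_sub_exp_ne_zero_of_not_dvd hN hdvd), mul_sub,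
      mul_one, ← Complex.exp_add]
    push_cast
    congr 2
    ring
  have hphase : Complex.exp (2 * Real.pi * Complex.I * n / N) ^ (N - P) =
      Complex.exp (-(2 * Real.pi * Complex.I * n * P / N)) := by
    rw [← Complex.exp_nat_mul, Complex.exp_eq_exp_iff_exists_int]
    refine ⟨n, ?_⟩
    push_cast [Nat.cast_sub hPN.le]
    field_simp
    ring
  rw [hφ, Finset.prod_congr rfl hfactor, Finset.prod_mul_distrib, Finset.prod_const, hcard,
    hphase, Complex.exp_add, Complex.exp_sum]
end

section
/- For every n ∈ J^c, φ₁(n) = N · exp( −2πin(N−P)/N − β(n) ), where β(n) = Σ_{k∈J^c} α(n−k). -/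
open Finset

/-- The derivative of `X ^ N - 1` at an `N`-th root of unity, as a product of differences. -/
theorem IsPrimitiveRoot.prod_erase_pow_sub_pow {K : Type*} [Field K] {N : ℕ} {ζ : K}
    (hζ : IsPrimitiveRoot ζ N) {n : ℕ} (hn : n ∈ range N) :
    ∏ k ∈ (range N).erase n, (ζ ^ n - ζ ^ k) = N * (ζ ^ n) ^ (N - 1) := by
  have hN : 0 < N := (Nat.zero_le n).trans_lt (mem_range.1 hn)
  have hnodal : Lagrange.nodal (range N) (fun k => ζ ^ k) = Polynomial.X ^ N - 1 := by
    have h := X_pow_sub_C_eq_prod hζ hN (one_pow N)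
    simp only [mul_one, map_one] at h
    rw [h, Lagrange.nodal]
  have h := Lagrange.eval_nodal_derivative_eval_node_eq (v := fun k => ζ ^ k) hn
  rw [hnodal, Lagrange.eval_nodal] at h
  simpa [Polynomial.derivative_X_pow] using h.symm

/-- For `n ∈ Jᶜ`, `φ₁(n) = N · exp(−2πin(N−P)/N − β(n))` where `β(n) = Σ_{k∈Jᶜ} α(n−k)`. -/
theorem complement_values_via_erasure_convolution
    (N P : ℕ) (hP : 0 < P) (hPN : P < N)
    (J : Finset ℕ) (hJsub : J ⊆ Finset.range N) (hJcard : J.card = P)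
    (φ₁ : ℝ → ℂ)
    (hφ₁ : ∀ t : ℝ, φ₁ t =
      ∏ k ∈ J,
        (Complex.exp (2 * Real.pi * Complex.I * t / N) -
          Complex.exp (2 * Real.pi * Complex.I * k / N)))
    (α : ℤ → ℂ)
    (hα : ∀ m : ℤ, α m =
      if (N : ℤ) ∣ m then 0
      else Complex.log (1 - Complex.exp (-(2 * Real.pi * Complex.I * m / N))))
    (n : ℕ) (hn : n ∈ Finset.range N \ J) :
    φ₁ n = (N : ℂ) * Complex.exp (-(2 * Real.pi * Complex.I * n * ((N : ℂ) - P) / N) -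
      ∑ k ∈ Finset.range N \ J, α ((n : ℤ) - k)) := by
  have hN : N ≠ 0 := by omega
  have hζ := Complex.isPrimitiveRoot_exp N hN
  set ζ := Complex.exp (2 * Real.pi * Complex.I / N) with hζdef
  have hpow (k : ℕ) : Complex.exp (2 * Real.pi * Complex.I * k / N) = ζ ^ k := by
    rw [hζdef, ← Complex.exp_nat_mul]
    congr 1
    ring
  have hζ0 : ζ ≠ 0 := Complex.exp_ne_zero _
  obtain ⟨hnN, hnJ⟩ := mem_sdiff.1 hn
  have hα0 : α ((n : ℤ) - n) = 0 := by simp [hα]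
  have hfactor : ∀ k ∈ (range N \ J).erase n,
      ζ ^ n - ζ ^ k = ζ ^ n * Complex.exp (α ((n : ℤ) - k)) := by
    intro k hk
    obtain ⟨hkn, hk⟩ := mem_erase.1 hk
    have hkN := mem_range.1 (mem_sdiff.1 hk).1
    have hnN' := mem_range.1 hnN
    have hdvd : ¬ (N : ℤ) ∣ (n : ℤ) - k := by
      intro h
      have := Int.eq_zero_of_abs_lt_dvd h (by rw [abs_lt]; omega)
      omega
    have hexp : ζ ^ n * Complex.exp (-(2 * Real.pi * Complex.I * ((n : ℤ) - k : ℤ) / N)) =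
        ζ ^ k := by
      rw [← hpow, ← hpow, ← Complex.exp_add]
      congr 1
      push_cast
      ring
    have hmul : ζ ^ n * (1 - Complex.exp (-(2 * Real.pi * Complex.I * ((n : ℤ) - k : ℤ) / N))) =
        ζ ^ n - ζ ^ k := by
      rw [mul_sub, hexp, mul_one]
    have hne : ζ ^ n - ζ ^ k ≠ 0 :=
      sub_ne_zero.2 fun h => hkn (hζ.pow_inj hnN' hkN h).symm
    rw [hα, if_neg hdvd, Complex.exp_log, hmul]
    exact right_ne_zero_of_mul (hmul ▸ hne)
  have hcard : ((range N \ J).erase n).card = N - P - 1 := by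
    rw [card_erase_of_mem hn, card_sdiff_of_subset hJsub, card_range, hJcard]
  have hcompl : ∏ k ∈ (range N \ J).erase n, (ζ ^ n - ζ ^ k) =
      (ζ ^ n) ^ (N - P - 1) * Complex.exp (∑ k ∈ range N \ J, α ((n : ℤ) - k)) := by
    rw [prod_congr rfl hfactor, prod_mul_distrib, prod_const, hcard, ← Complex.exp_sum,
      sum_erase (f := fun k : ℕ => α ((n : ℤ) - k)) _ hα0]
  have hsplit : (∏ k ∈ J, (ζ ^ n - ζ ^ k)) * ∏ k ∈ (range N \ J).erase n, (ζ ^ n - ζ ^ k) =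
      N * (ζ ^ n) ^ (N - 1) := by
    rw [← hζ.prod_erase_pow_sub_pow hnN, mul_comm, ← erase_sdiff_comm,
      prod_sdiff (subset_erase.2 ⟨hJsub, hnJ⟩)]
  have hphase : Complex.exp (-(2 * Real.pi * Complex.I * n * ((N : ℂ) - P) / N)) =
      (ζ ^ n) ^ P := by
    have h1 : (ζ ^ n) ^ N = 1 := by rw [← pow_mul, mul_comm, pow_mul, hζ.pow_eq_one, one_pow]
    have h2 : (ζ ^ n) ^ (N - P) * (ζ ^ n) ^ P = 1 := by
      rw [← pow_add, Nat.sub_add_cancel hPN.le, h1]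
    rw [Complex.exp_neg, eq_inv_of_mul_eq_one_right h2, ← hpow, ← Complex.exp_nat_mul,
      Nat.cast_sub hPN.le]
    congr 2
    ring
  rw [hφ₁, Complex.exp_sub, hphase]
  simp only [Complex.ofReal_natCast, hpow]
  rw [hcompl] at hsplit
  have hN1 : (ζ ^ n) ^ (N - 1) = (ζ ^ n) ^ (N - P - 1) * (ζ ^ n) ^ P := by
    rw [← pow_add]
    congr 1
    omega
  rw [hN1] at hsplit
  rw [← mul_div_assoc, eq_div_iff (Complex.exp_ne_zero _)]
  refine mul_left_cancel₀ (pow_ne_zero (N - P - 1) (pow_ne_zero n hζ0)) ?_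
  linear_combination hsplit
end

section
/- For every integer q, Σ_{p=0}^{N−P} φ_{N−P−p} · S_{J^c,q+p} = 0, where φ₀,…,φ_{N−P} are the coefficients of the erasure polynomial written as ∏_{k∈J^c}(z − e^{2πik/N}) = Σ_{p=0}^{N−P} φ_p z^p, and S_{J^c,p} = (1/N) Σ_{n∈J^c} s(n) e^{−2πipn/N} is extended N-periodically in p. (This is the cyclic-convolution relation obtained by taking the identity s_{J^c}(n)·φ(n) = 0 for all n to the frequency domain.) -/
open Finset

/-- Cyclic-convolution relation: `Σ_{p=0}^{N−P} φ_{N−P−p} · S_{Jᶜ,q+p} = 0` for every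
integer `q`, where `φ_p` are the coefficients of the erasure polynomial and `S_{Jᶜ,p}`
is the (N-periodic) DFT of the missing-samples signal. -/
theorem erasure_convolution_annihilates
    (N P : ℕ) (hP : 0 < P) (hPN : P < N)
    (J : Finset ℕ) (hJsub : J ⊆ Finset.range N) (hJcard : J.card = P)
    (S : ℕ → ℂ)
    (s : ℝ → ℂ)
    (hs : ∀ t : ℝ, s t =
      ∑ p ∈ Finset.range P, S p * Complex.exp (2 * Real.pi * Complex.I * p * t / N))
    (φc : ℕ → ℂ)
    (hφc : ∀ z : ℂ,
      ∏ k ∈ Finset.range N \ J, (z - Complex.exp (2 * Real.pi * Complex.I * k / N)) =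
        ∑ p ∈ Finset.range (N - P + 1), φc p * z ^ p)
    (SJc : ℤ → ℂ)
    (hSJc : ∀ p : ℤ, SJc p =
      ((1 : ℂ) / N) * ∑ n ∈ Finset.range N \ J,
        s n * Complex.exp (-(2 * Real.pi * Complex.I * p * n / N)))
    (q : ℤ) :
    ∑ p ∈ Finset.range (N - P + 1), φc (N - P - p) * SJc (q + p) = 0 := by
  have root_sum (n : ℕ) (hn : n ∈ Finset.range N \ J) :
      ∑ p ∈ Finset.range (N - P + 1), φc (N - P - p) *
        Complex.exp (-(2 * Real.pi * Complex.I * ((q + p : ℤ) : ℂ) * n / N)) = 0 := by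
    set w := Complex.exp (2 * Real.pi * Complex.I * n / N) with hw
    have hroot : ∑ p ∈ Finset.range (N - P + 1), φc p * w ^ p = 0 := by
      rw [← hφc w]
      exact Finset.prod_eq_zero hn (sub_self _)
    rw [← Finset.sum_range_reflect] at hroot
    have hfactor : ∑ p ∈ Finset.range (N - P + 1), φc (N - P - p) *
          Complex.exp (-(2 * Real.pi * Complex.I * ((q + p : ℤ) : ℂ) * n / N)) =
        Complex.exp (-(2 * Real.pi * Complex.I * (q + (N - P : ℕ)) * n / N)) *
          ∑ p ∈ Finset.range (N - P + 1),
            φc (N - P + 1 - 1 - p) * w ^ (N - P + 1 - 1 - p) := by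
      rw [Finset.mul_sum]
      refine Finset.sum_congr rfl fun p hp => ?_
      have hpM : p ≤ N - P := Nat.lt_succ_iff.mp (Finset.mem_range.mp hp)
      rw [Nat.add_sub_cancel, hw, ← Complex.exp_nat_mul, mul_left_comm, ← Complex.exp_add,
        Nat.cast_sub hpM]
      congr 2
      push_cast
      ring
    rw [hfactor, hroot, mul_zero]
  simp_rw [hSJc, Finset.mul_sum]
  rw [Finset.sum_comm]
  refine Finset.sum_eq_zero fun n hn => ?_
  rw [← mul_zero ((1 : ℂ) / N * s n), ← root_sum n hn, Finset.mul_sum]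
  exact Finset.sum_congr rfl fun p _ => by ring
end

section
/- The erasure polynomial is monic, i.e., φ_{N−P} = 1 in the expansion ∏_{k∈J^c}(z − e^{2πik/N}) = Σ_{p=0}^{N−P} φ_p z^p, and consequently for every integer q, S_{J^c,q} = −Σ_{p=1}^{N−P} φ_{N−P−p} · S_{J^c,q+p}, where S_{J^c,p} = (1/N) Σ_{n∈J^c} s(n) e^{−2πipn/N} is extended N-periodically in p. (This is the recursion of the burst error recovery technique.) -/
open Finset

/-- Coefficients of a monic product expanded as a polynomial function: the top one is `1`. -/
theorem top_coeff_eq_one_of_prod_sub_eq_sum {ι : Type*} (A : Finset ι) (r : ι → ℂ) (c : ℕ → ℂ)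
    (h : ∀ z : ℂ, ∏ k ∈ A, (z - r k) = ∑ p ∈ Finset.range (A.card + 1), c p * z ^ p) :
    c A.card = 1 := by
  have hpoly : ∏ k ∈ A, (Polynomial.X - Polynomial.C (r k)) =
      ∑ p ∈ Finset.range (A.card + 1), Polynomial.C (c p) * Polynomial.X ^ p := by
    refine Polynomial.funext fun z => ?_
    simpa [Polynomial.eval_prod, Polynomial.eval_finsetSum] using h z
  have hmonic := Polynomial.monic_prod_of_monic A (fun k => Polynomial.X - Polynomial.C (r k))
    fun k _ => Polynomial.monic_X_sub_C (r k)
  have hdeg : (∏ k ∈ A, (Polynomial.X - Polynomial.C (r k))).natDegree = A.card := by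
    simp
  rw [Polynomial.Monic, Polynomial.leadingCoeff, hdeg, hpoly] at hmonic
  simpa [Polynomial.finsetSum_coeff, Polynomial.coeff_C_mul, Polynomial.coeff_X_pow]
    using hmonic

/-- If `w` is a nonzero root of `∑ c p z ^ p`, then `w⁻¹` is a root of the reversed sum. -/
theorem sum_reverse_mul_inv_pow_eq_zero (M : ℕ) (c : ℕ → ℂ) (w : ℂ) (hw : w ≠ 0)
    (h : ∑ p ∈ Finset.range (M + 1), c p * w ^ p = 0) :
    ∑ p ∈ Finset.range (M + 1), c (M - p) * w⁻¹ ^ p = 0 := by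
  rw [← Finset.sum_range_reflect] at h
  have hfac : ∑ p ∈ Finset.range (M + 1), c (M - p) * w⁻¹ ^ p =
      w⁻¹ ^ M * ∑ p ∈ Finset.range (M + 1), c (M + 1 - 1 - p) * w ^ (M + 1 - 1 - p) := by
    rw [Finset.mul_sum]
    refine Finset.sum_congr rfl fun p hp => ?_
    obtain ⟨m, rfl⟩ := Nat.exists_eq_add_of_le (Nat.lt_succ_iff.mp (Finset.mem_range.mp hp))
    simp only [Nat.add_sub_cancel, Nat.add_sub_cancel_left, pow_add, inv_pow]
    field_simp
  rw [hfac, h, mul_zero]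

/-- The erasure polynomial is monic, `φ_{N−P} = 1`, and consequently the burst error
recovery recursion holds: `S_{Jᶜ,q} = −Σ_{p=1}^{N−P} φ_{N−P−p} · S_{Jᶜ,q+p}`. -/
theorem ber_recursion
    (N P : ℕ) (hP : 0 < P) (hPN : P < N)
    (J : Finset ℕ) (hJsub : J ⊆ Finset.range N) (hJcard : J.card = P)
    (S : ℕ → ℂ)
    (s : ℝ → ℂ)
    (hs : ∀ t : ℝ, s t =
      ∑ p ∈ Finset.range P, S p * Complex.exp (2 * Real.pi * Complex.I * p * t / N))
    (φc : ℕ → ℂ)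
    (hφc : ∀ z : ℂ,
      ∏ k ∈ Finset.range N \ J, (z - Complex.exp (2 * Real.pi * Complex.I * k / N)) =
        ∑ p ∈ Finset.range (N - P + 1), φc p * z ^ p)
    (SJc : ℤ → ℂ)
    (hSJc : ∀ p : ℤ, SJc p =
      ((1 : ℂ) / N) * ∑ n ∈ Finset.range N \ J,
        s n * Complex.exp (-(2 * Real.pi * Complex.I * p * n / N))) :
    φc (N - P) = 1 ∧
      ∀ q : ℤ, SJc q = -∑ p ∈ Finset.Icc 1 (N - P), φc (N - P - p) * SJc (q + p) := by
  have hcard : (Finset.range N \ J).card = N - P := by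
    rw [Finset.card_sdiff_of_subset hJsub, Finset.card_range, hJcard]
  have hmonic : φc (N - P) = 1 := by
    rw [← hcard] at hφc ⊢
    exact top_coeff_eq_one_of_prod_sub_eq_sum _ _ φc hφc
  refine ⟨hmonic, fun q => ?_⟩
  have hzero : ∑ p ∈ Finset.range (N - P + 1), φc (N - P - p) * SJc (q + p) = 0 := by
    simp only [hSJc, Finset.mul_sum]
    rw [Finset.sum_comm]
    refine Finset.sum_eq_zero fun n hn => ?_
    have hroot := sum_reverse_mul_inv_pow_eq_zero (N - P) φc
      (Complex.exp (2 * Real.pi * Complex.I * n / N)) (Complex.exp_ne_zero _)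
      (by rw [← hφc]; exact Finset.prod_eq_zero hn (sub_self _))
    rw [← mul_zero ((1 : ℂ) / N * s n * Complex.exp (-(2 * Real.pi * Complex.I * q * n / N))),
      ← hroot, Finset.mul_sum]
    refine Finset.sum_congr rfl fun p _ => ?_
    have hexp : Complex.exp (-(2 * Real.pi * Complex.I * ((q + p : ℤ) : ℂ) * n / N)) =
        Complex.exp (-(2 * Real.pi * Complex.I * q * n / N)) *
          (Complex.exp (2 * Real.pi * Complex.I * n / N))⁻¹ ^ p := by
      rw [← Complex.exp_neg, ← Complex.exp_nat_mul, ← Complex.exp_add]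
      congr 1
      push_cast
      ring
    rw [hexp]
    ring
  rw [Finset.range_eq_Ico, Finset.sum_eq_sum_Ico_succ_bot (Nat.succ_pos _)] at hzero
  simp only [Nat.sub_zero, hmonic, one_mul, Nat.cast_zero, add_zero, zero_add] at hzero
  exact eq_neg_of_add_eq_zero_left hzero
end
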